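/- f(2q − 1) = q + 1, f(2q) = 2, and f(2q + 1) = q − 1. -/

import Mathlib

open scoped BigOperators

/-- Points (and, by self-duality of homogeneous coordinates, lines) of the
Desarguesian projective plane `PG(2,q)` over the field `F`. -/
abbrev PG (F : Type*) [Field F] := Projectivization F (Fin 3 → F)

/-- Incidence between a point and a line (the line being given by its dual
homogeneous coordinates): the dot product of representatives vanishes.
This does not depend on the choice of representatives. -/
def Incid {F : Type*} [Field F] (p l : PG F) : Prop :=
  ∑ i, p.rep i * l.rep i = 0

/-- `𝒫ᵒ(R)`: points incident with an odd number of lines of `R`. -/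
def Podd (F : Type*) [Field F] (R : Set (PG F)) : Set (PG F) :=
  {p | Odd {l ∈ R | Incid p l}.ncard}

/-- `𝒫ᵉ(R)`: points incident with an even number of lines of `R`. -/
def Peven (F : Type*) [Field F] (R : Set (PG F)) : Set (PG F) :=
  {p | Even {l ∈ R | Incid p l}.ncard}

/-- `ℒᵒ(S)`: lines meeting `S` in an odd number of points. -/
def Lodd (F : Type*) [Field F] (S : Set (PG F)) : Set (PG F) :=
  {l | Odd {p ∈ S | Incid p l}.ncard}

/-- `ℒᵉ(S)`: lines meeting `S` in an even number of points. -/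
def Leven (F : Type*) [Field F] (S : Set (PG F)) : Set (PG F) :=
  {l | Even {p ∈ S | Incid p l}.ncard}

/-- `f(r)`: the minimum size of the symmetric difference of `r` distinct lines,
i.e. the minimum of `|𝒫ᵒ(R)|` over sets `R` of exactly `r` lines. -/
noncomputable def fmin (F : Type*) [Field F] (r : ℕ) : ℕ :=
  sInf {n | ∃ R : Set (PG F), R.ncard = r ∧ (Podd F R).ncard = n}

open Finset in
/-- Abstract self-dual finite projective plane of odd order `q`. -/
structure IsPl {V : Type*} [Fintype V] [DecidableEq V] (I : V → V → Prop) [DecidableRel I]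
    (q : ℕ) : Prop where
  symm : ∀ p l, I p l → I l p
  deg : ∀ p, (univ.filter (fun l => I p l)).card = q + 1
  two : ∀ p p', p ≠ p' → (univ.filter (fun l => I p l ∧ I p' l)).card = 1
  card : Fintype.card V = q ^ 2 + q + 1
  odd : Odd q
  gt : 1 < q

namespace IsPl
open Finset

variable {V : Type*} [Fintype V] [DecidableEq V] {I : V → V → Prop} [DecidableRel I] {q : ℕ}

/-- Odd points of a finite set of lines. -/
def Od (I : V → V → Prop) [DecidableRel I] (R : Finset V) : Finset V :=
  univ.filter (fun p => Odd (R.filter (fun l => I p l)).card)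

theorem symm_iff (h : IsPl I q) (p l : V) : I p l ↔ I l p := ⟨h.symm _ _, h.symm _ _⟩

theorem even_card_Od (h : IsPl I q) (R : Finset V) : Even (Od I R).card := by
  rw [← Nat.not_odd_iff_even, Od, ← Finset.odd_sum_iff_odd_card_odd, Nat.not_odd_iff_even]
  have : ∑ p, (R.filter (fun l => I p l)).card = R.card * (q + 1) := by
    simp_rw [card_filter]
    rw [sum_comm]
    simp_rw [← card_filter, h.symm_iff _]
    rw [Finset.sum_const_nat]
    intro x _
    rw [← h.deg x]
  rw [this]
  exact (h.odd.add_one).mul_left _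

theorem odd_inter (h : IsPl I q) (R : Finset V) (m : V) :
    Odd ((Od I R).filter (fun p => I m p)).card ↔ Odd (R.card + if m ∈ R then 1 else 0) := by
  have e : (Od I R).filter (fun p => I m p)
      = (univ.filter (fun p => I m p)).filter
          (fun p => Odd (R.filter (fun l => I p l)).card) := by
    ext p; simp [Od, and_comm]
  rw [e, ← Finset.odd_sum_iff_odd_card_odd]
  have : ∑ p ∈ univ.filter (fun p => I m p), (R.filter (fun l => I p l)).card
      = R.card + if m ∈ R then q else 0 := by
    simp_rw [card_filter]
    rw [sum_comm]
    have : ∀ l ∈ R, (∑ p ∈ univ.filter (fun p => I m p), if I p l then 1 else 0)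
        = 1 + if m = l then q else 0 := by
      intro l _
      rw [← card_filter, filter_filter]
      simp_rw [h.symm_iff _ l]
      split_ifs with hl
      · subst hl; simp only [and_self]; rw [h.deg]; omega
      · exact h.two _ _ hl
    rw [Finset.sum_congr rfl this, Finset.sum_add_distrib]
    simp
  rw [this]
  have := h.odd
  split_ifs
  · simp only [Nat.odd_iff] at *; omega
  · rfl

theorem lower_even (h : IsPl I q) (R : Finset V) (hR : R.card = 2 * q) : 2 ≤ (Od I R).card := by
  obtain ⟨k, hk⟩ := h.even_card_Od R
  by_contra hlt
  have h0 : Od I R = ∅ := by rw [← Finset.card_eq_zero]; omega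
  have hg := h.gt
  obtain ⟨m, hm⟩ : R.Nonempty := by rw [← Finset.card_pos]; omega
  have := h.odd_inter R m
  rw [h0, hR, if_pos hm] at this
  simp at this

theorem lower_odd (h : IsPl I q) (R : Finset V) (hR : Odd R.card) :
    q ^ 2 + q + 1 ≤ R.card + (Od I R).card * q := by
  have h1 : Rᶜ ⊆ (Od I R).biUnion (fun p => (univ.filter (fun l => I p l)) \ R) := by
    intro m hm
    have hm' : m ∉ R := by simpa using hm
    have := (h.odd_inter R m).2 (by simpa [hm'] using hR)
    obtain ⟨p, hp⟩ := Finset.card_pos.1 this.pos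
    simp only [mem_filter] at hp
    simp only [mem_biUnion, mem_sdiff, mem_filter, mem_univ, true_and]
    exact ⟨p, hp.1, h.symm _ _ hp.2, hm'⟩
  have h2 : ((Od I R).biUnion (fun p => (univ.filter (fun l => I p l)) \ R)).card
      ≤ (Od I R).card * q := by
    apply Finset.card_biUnion_le_card_mul
    intro p hp
    simp only [Od, mem_filter, mem_univ, true_and] at hp
    obtain ⟨l, hl⟩ := Finset.card_pos.1 hp.pos
    simp only [mem_filter] at hl
    have : (univ.filter (fun l => I p l)) \ R ⊂ univ.filter (fun l => I p l) := by
      rw [Finset.ssubset_iff_of_subset sdiff_subset]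
      exact ⟨l, by simp [hl.2], by simp [hl.1]⟩
    have := Finset.card_lt_card this
    rw [h.deg] at this
    omega
  have h3 := Finset.card_le_card h1
  have h4 := Finset.card_add_card_compl R
  rw [h.card] at h4
  omega

theorem card_symmDiff' (A B : Finset V) :
    (symmDiff A B).card + 2 * (A ∩ B).card = A.card + B.card := by
  have h1 : symmDiff A B = (A \ B) ∪ (B \ A) := rfl
  rw [h1, Finset.card_union_of_disjoint disjoint_sdiff_sdiff]
  have := Finset.card_sdiff_add_card_inter A B
  have := Finset.card_sdiff_add_card_inter B A
  rw [Finset.inter_comm B A] at this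
  omega

theorem Od_symmDiff (A B : Finset V) : Od I (symmDiff A B) = symmDiff (Od I A) (Od I B) := by
  ext p
  have e : (symmDiff A B).filter (fun l => I p l)
      = symmDiff (A.filter (fun l => I p l)) (B.filter (fun l => I p l)) := by
    ext l; simp only [mem_filter, mem_symmDiff]; tauto
  have := card_symmDiff' (A.filter (fun l => I p l)) (B.filter (fun l => I p l))
  simp only [Od, mem_filter, mem_symmDiff, mem_univ, true_and, e, Nat.odd_iff]
  omega

theorem Od_pencil (h : IsPl I q) (P : V) : Od I (univ.filter (fun l => I P l)) = {P}ᶜ := by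
  ext p
  simp only [Od, mem_filter, mem_univ, true_and, filter_filter, mem_compl, mem_singleton]
  by_cases hp : p = P
  · subst hp
    simp only [and_self, h.deg, not_true, iff_false, Nat.not_odd_iff_even]
    exact h.odd.add_one
  · rw [h.two _ _ (Ne.symm hp)]; simp [hp]

theorem Od_single (h : IsPl I q) (m : V) : Od I {m} = univ.filter (fun p => I m p) := by
  ext p
  simp only [Od, mem_filter, mem_univ, true_and, filter_singleton, h.symm_iff m p]
  split_ifs with hh <;> simp [hh]

/-- Lines through exactly one of two points. -/
def R0 (I : V → V → Prop) [DecidableRel I] (P Q : V) : Finset V :=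
  symmDiff (univ.filter (fun l => I P l)) (univ.filter (fun l => I Q l))

theorem card_R0 (h : IsPl I q) {P Q : V} (hPQ : P ≠ Q) : (R0 I P Q).card = 2 * q := by
  have := card_symmDiff' (univ.filter (fun l => I P l)) (univ.filter (fun l => I Q l))
  rw [← filter_and, h.two _ _ hPQ, h.deg, h.deg] at this
  rw [R0]; omega

theorem Od_R0 (h : IsPl I q) {P Q : V} (hPQ : P ≠ Q) : Od I (R0 I P Q) = {P, Q} := by
  rw [R0, Od_symmDiff, h.Od_pencil, h.Od_pencil]
  ext x
  simp only [mem_symmDiff, mem_compl, mem_singleton, mem_insert]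
  have := hPQ
  grind

theorem exists_even (h : IsPl I q) : ∃ R : Finset V, R.card = 2 * q ∧ (Od I R).card = 2 := by
  have hc : 1 < Fintype.card V := by rw [h.card]; have := h.gt; nlinarith
  obtain ⟨P, Q, hPQ⟩ := Fintype.one_lt_card_iff.1 hc
  exact ⟨R0 I P Q, h.card_R0 hPQ, by rw [h.Od_R0 hPQ, card_pair hPQ]⟩

theorem exists_plus (h : IsPl I q) :
    ∃ R : Finset V, R.card = 2 * q + 1 ∧ (Od I R).card = q - 1 := by
  have hc : 1 < Fintype.card V := by rw [h.card]; have := h.gt; nlinarith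
  obtain ⟨P, Q, hPQ⟩ := Fintype.one_lt_card_iff.1 hc
  obtain ⟨m, hm⟩ := Finset.card_pos.1 (by rw [h.two P Q hPQ]; exact one_pos)
  simp only [mem_filter, mem_univ, true_and] at hm
  refine ⟨symmDiff (R0 I P Q) {m}, ?_, ?_⟩
  · have := card_symmDiff' (R0 I P Q) {m}
    have e : R0 I P Q ∩ {m} = ∅ := by
      rw [Finset.inter_singleton_of_notMem]
      simp [R0, mem_symmDiff, hm]
    rw [e, h.card_R0 hPQ, card_singleton, card_empty] at this
    omega
  · rw [Od_symmDiff, h.Od_R0 hPQ, h.Od_single]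
    have := card_symmDiff' {P, Q} (univ.filter (fun p => I m p))
    have e : {P, Q} ∩ univ.filter (fun p => I m p) = {P, Q} := by
      rw [Finset.inter_eq_left]
      intro x hx
      simp only [mem_insert, mem_singleton] at hx
      rcases hx with rfl | rfl <;> simp [h.symm_iff m, hm]
    rw [e, card_pair hPQ, h.deg] at this
    omega

theorem exists_minus (h : IsPl I q) :
    ∃ R : Finset V, R.card = 2 * q - 1 ∧ (Od I R).card = q + 1 := by
  have hg := h.gt
  have hc : 1 < Fintype.card V := by rw [h.card]; nlinarith
  obtain ⟨P, Q, hPQ⟩ := Fintype.one_lt_card_iff.1 hc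
  obtain ⟨m, hm1, hm2⟩ : ∃ m, I P m ∧ ¬ I Q m := by
    by_contra hcon
    push Not at hcon
    have e : univ.filter (fun l => I P l ∧ I Q l) = univ.filter (fun l => I P l) := by
      ext l; simpa using hcon l
    have := h.two P Q hPQ
    rw [e, h.deg] at this
    omega
  refine ⟨symmDiff (R0 I P Q) {m}, ?_, ?_⟩
  · have := card_symmDiff' (R0 I P Q) {m}
    have e : R0 I P Q ∩ {m} = {m} := by
      rw [Finset.inter_singleton_of_mem]
      simp [R0, mem_symmDiff, hm1, hm2]
    rw [e, h.card_R0 hPQ, card_singleton] at this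
    omega
  · rw [Od_symmDiff, h.Od_R0 hPQ, h.Od_single]
    have := card_symmDiff' {P, Q} (univ.filter (fun p => I m p))
    have e : {P, Q} ∩ univ.filter (fun p => I m p) = {P} := by
      ext x
      simp only [mem_insert, mem_singleton, mem_inter, mem_filter, mem_univ, true_and,
        h.symm_iff m]
      constructor
      · rintro ⟨rfl | rfl, hx⟩
        · rfl
        · exact absurd hx hm2
      · rintro rfl
        exact ⟨Or.inl rfl, hm1⟩
    rw [e, card_pair hPQ, h.deg, card_singleton] at this
    omega

end IsPl

theorem incid_iff {F : Type*} [Field F] (p l : PG F) :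
    Incid p l ↔ Projectivization.orthogonal p l := by
  conv_rhs => rw [← p.mk_rep, ← l.mk_rep]
  rw [Projectivization.orthogonal_mk]
  rfl

open Classical in
theorem isPl_PG {F : Type*} [Field F] [Fintype F] [Fintype (PG F)] (q : ℕ)
    (hcard : Fintype.card F = q) (hq : Odd q) : IsPl (Incid : PG F → PG F → Prop) q := by
  have hN : Fintype.card (PG F) = q ^ 2 + q + 1 := by
    have := Projectivization.card_of_finrank F (Fin 3 → F) (n := 3) (by simp)
    rw [Nat.card_eq_fintype_card, Nat.card_eq_fintype_card, hcard] at this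
    rw [this]
    simp [Finset.sum_range_succ]; ring
  have ho : Configuration.ProjectivePlane.order (PG F) (PG F) = q := by
    have := Configuration.ProjectivePlane.card_points (PG F) (PG F)
    rw [hN] at this
    nlinarith
  refine ⟨?_, ?_, ?_, hN, hq, ?_⟩
  · intro p l hpl
    rw [incid_iff] at *
    exact Projectivization.orthogonal_comm.1 hpl
  · intro p
    have := Configuration.ProjectivePlane.lineCount_eq (PG F) p
    rw [ho, Configuration.lineCount, Nat.card_eq_fintype_card, Fintype.card_subtype] at this
    rw [← this]
    congr 1
    ext l
    simp [incid_iff, Configuration.ofField.mem_iff]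
  · intro p p' hne
    rw [Finset.card_eq_one]
    obtain ⟨l, hl, hu⟩ := Configuration.HasLines.existsUnique_line (PG F) (PG F) p p' hne
    refine ⟨l, ?_⟩
    ext m
    simp only [Finset.mem_filter, Finset.mem_univ, true_and, Finset.mem_singleton, incid_iff]
    exact ⟨fun hm => hu m hm, fun hm => hm ▸ hl⟩
  · rw [← hcard]; exact Fintype.one_lt_card

open Classical in
theorem ncard_Podd {F : Type*} [Field F] [Fintype (PG F)] (R : Finset (PG F)) :
    (Podd F (R : Set (PG F))).ncard = (IsPl.Od (Incid : PG F → PG F → Prop) R).card := by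
  rw [← Set.ncard_coe_finset]
  congr 1
  ext p
  simp only [Podd, IsPl.Od, Set.mem_setOf_eq, Finset.coe_filter, Finset.mem_univ, true_and]
  rw [← Set.ncard_coe_finset]
  simp

open Classical in
theorem fmin_eq {F : Type*} [Field F] [Fintype (PG F)] (r n : ℕ)
    (hex : ∃ R : Finset (PG F), R.card = r ∧
      (IsPl.Od (Incid : PG F → PG F → Prop) R).card = n)
    (hlow : ∀ R : Finset (PG F), R.card = r →
      n ≤ (IsPl.Od (Incid : PG F → PG F → Prop) R).card) : fmin F r = n := by
  apply le_antisymm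
  · obtain ⟨R, h1, h2⟩ := hex
    exact Nat.sInf_le ⟨R, by rw [Set.ncard_coe_finset, h1], by rw [ncard_Podd, h2]⟩
  · apply le_csInf
    · obtain ⟨R, h1, h2⟩ := hex
      exact ⟨n, R, by rw [Set.ncard_coe_finset, h1], by rw [ncard_Podd, h2]⟩
    · rintro k ⟨R, h1, rfl⟩
      obtain ⟨T, rfl⟩ := (Set.toFinite R).exists_finset_coe
      rw [ncard_Podd]
      exact hlow T (by rwa [Set.ncard_coe_finset] at h1)

/-- `f(2q − 1) = q + 1`, `f(2q) = 2`, and `f(2q + 1) = q − 1`. -/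
theorem stmt8 {F : Type*} [Field F] [Fintype F] (q : ℕ)
    (hcard : Fintype.card F = q) (hq : Odd q) :
    fmin F (2 * q - 1) = q + 1 ∧ fmin F (2 * q) = 2 ∧ fmin F (2 * q + 1) = q - 1 := by
  classical
  haveI : Fintype (PG F) := Fintype.ofFinite _
  have h := isPl_PG q hcard hq
  have hg := h.gt
  refine ⟨fmin_eq _ _ h.exists_minus ?_, fmin_eq _ _ h.exists_even h.lower_even,
    fmin_eq _ _ h.exists_plus ?_⟩
  · intro R hR
    have h1 := h.lower_odd R (by rw [hR, Nat.odd_iff]; omega)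
    obtain ⟨k, hk⟩ := h.even_card_Od R
    obtain ⟨j, hj⟩ := hq
    by_contra hlt
    have hle : (IsPl.Od (Incid : PG F → PG F → Prop) R).card ≤ q - 1 := by omega
    have h2 := Nat.mul_le_mul_right q hle
    obtain ⟨t, rfl⟩ : ∃ t, q = t + 1 := ⟨q - 1, by omega⟩
    have h3 : R.card = 2 * t + 1 := by omega
    rw [Nat.add_sub_cancel] at h2
    nlinarith
  · intro R hR
    have h1 := h.lower_odd R (by rw [hR, Nat.odd_iff]; omega)
    by_contra hlt
    have hle : (IsPl.Od (Incid : PG F → PG F → Prop) R).card ≤ q - 2 := by omega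
    have h2 := Nat.mul_le_mul_right q hle
    obtain ⟨t, rfl⟩ : ∃ t, q = t + 2 := ⟨q - 2, by omega⟩
    rw [Nat.add_sub_cancel] at h2
    nlinarith
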